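/- arXiv:1911.05896 — 4 statements merged into one kernel-verified Lean document; each statement's English description precedes it below -/
import Mathlib

section
/- Let D be a finite directed graph with m edges in which every vertex has out-degree at most κ, and let T be a directed rooted tree on k ≥ 2 vertices whose edges are all oriented away from the root. Then the number of injective digraph homomorphisms from T into D (injective maps f : V(T) → V(D) such that (f(a), f(b)) is an edge of D whenever (a,b) is an edge of T) is at most m · κ^(k−2). -/
/-- In a connected digraph in which every non-root vertex has a unique in-neighbour, a proper
set of vertices containing the root and closed under taking in-neighbours has an edge leaving it. -/
theorem exists_unique_parent_of_ne_univ {W : Type*} {T : W → W → Prop} {root : W}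
    (hconn : (SimpleGraph.fromRel T).Connected)
    (hindeg : ∀ w : W, w ≠ root → {u | T u w}.ncard = 1)
    {S : Set W} (hS : root ∈ S) (hclosed : ∀ a b, b ∈ S → T a b → a ∈ S) (hne : S ≠ Set.univ) :
    ∃ u ∈ S, ∃ w ∉ S, T u w ∧ ∀ a, T a w → a = u := by
  obtain ⟨x, hx⟩ := (Set.ne_univ_iff_exists_notMem S).1 hne
  obtain ⟨p⟩ := hconn.preconnected root x
  obtain ⟨d, -, hu, hw⟩ := p.exists_boundary_dart S hS hx
  have hT : T d.fst d.snd :=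
    ((SimpleGraph.fromRel_adj _ _ _).1 d.adj).2.resolve_right fun h ↦ hw (hclosed _ _ hu h)
  refine ⟨_, hu, _, hw, hT, fun a ha ↦ ?_⟩
  obtain ⟨b, hb⟩ := Set.ncard_eq_one.1 (hindeg d.snd fun h ↦ hw (h ▸ hS))
  have mem_iff (c : W) : T c d.snd ↔ c = b := Set.ext_iff.1 hb c
  rw [(mem_iff _).1 ha, (mem_iff _).1 hT]

open Classical in
/-- Adjoining to `S` an out-neighbour of one of its vertices multiplies the number of restrictions
of a family of homomorphisms by at most the maximum out-degree. -/
theorem card_image_restrict_insert_le {V W : Type*} [Fintype V]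
    {D : V → V → Prop} {κ : ℕ} (hκ : ∀ v : V, {w | D v w}.ncard ≤ κ)
    {T : W → W → Prop} (F : Finset (W → V)) (hF : ∀ f ∈ F, ∀ a b, T a b → D (f a) (f b))
    {S : Finset W} {u w : W} (hu : u ∈ S) (hT : T u w) :
    (F.image (insert w S).restrict).card ≤ κ * (F.image S.restrict).card := by
  have hsub : S ⊆ insert w S := Finset.subset_insert w S
  have himage : (F.image (insert w S).restrict).image (Finset.restrict₂ (π := fun _ ↦ V) hsub)
      = F.image S.restrict := by
    rw [Finset.image_image]
    rfl
  rw [← himage]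
  refine Finset.card_le_mul_card_image _ _ fun g _ ↦ ?_
  refine le_trans ?_ (hκ (g ⟨u, hu⟩))
  rw [← Set.ncard_coe_finset]
  refine Set.ncard_le_ncard_of_injOn (fun h ↦ h ⟨w, Finset.mem_insert_self w S⟩) ?_ ?_
    (Set.toFinite _)
  · intro h hh
    simp only [Finset.coe_filter, Finset.mem_image, Set.mem_ofPred_eq] at hh
    obtain ⟨⟨f, hf, rfl⟩, rfl⟩ := hh
    exact hF f hf u w hT
  · intro h₁ hh₁ h₂ hh₂ heq
    have hres := (Finset.mem_filter.1 hh₁).2.trans (Finset.mem_filter.1 hh₂).2.symm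
    funext ⟨x, hx⟩
    rcases Finset.mem_insert.1 hx with rfl | hxS
    · exact heq
    · exact congrFun hres ⟨x, hxS⟩

open Classical in
/-- The restrictions of a family of homomorphisms to the endpoints of an edge are determined by the
images of that edge. -/
theorem card_image_restrict_pair_le {V W : Type*} [Fintype V]
    {D : V → V → Prop} {T : W → W → Prop} (F : Finset (W → V))
    (hF : ∀ f ∈ F, ∀ a b, T a b → D (f a) (f b)) {u w : W} (hT : T u w) :
    (F.image (Finset.restrict (π := fun _ ↦ V) {w, u})).card
      ≤ {p : V × V | D p.1 p.2}.ncard := by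
  rw [← Set.ncard_coe_finset]
  refine Set.ncard_le_ncard_of_injOn
    (fun h ↦ (h ⟨u, by simp⟩, h ⟨w, by simp⟩)) ?_ ?_ (Set.toFinite _)
  · intro h hh
    obtain ⟨f, hf, rfl⟩ := Finset.mem_image.1 hh
    exact hF f hf u w hT
  · intro h₁ _ h₂ _ heq
    obtain ⟨hu, hw⟩ := Prod.mk.inj heq
    funext ⟨x, hx⟩
    rcases Finset.mem_insert.1 hx with rfl | hx'
    · exact hw
    · obtain rfl := Finset.mem_singleton.1 hx'
      exact hu

open Classical in
/-- A rooted tree has parent-closed vertex sets of every size `n + 2` to which a family of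
homomorphisms has at most `m * κ ^ n` restrictions. -/
theorem exists_card_image_restrict_le {V W : Type*} [Fintype V] [Fintype W]
    {D : V → V → Prop} {κ : ℕ} (hκ : ∀ v : V, {w | D v w}.ncard ≤ κ)
    {T : W → W → Prop} {root : W} (hconn : (SimpleGraph.fromRel T).Connected)
    (hroot : ∀ w : W, ¬ T w root)
    (hindeg : ∀ w : W, w ≠ root → {u | T u w}.ncard = 1)
    (F : Finset (W → V)) (hF : ∀ f ∈ F, ∀ a b, T a b → D (f a) (f b))
    (n : ℕ) (hn : n + 2 ≤ Fintype.card W) :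
    ∃ S : Finset W, root ∈ S ∧ (∀ a b, b ∈ S → T a b → a ∈ S) ∧ S.card = n + 2 ∧
      (F.image S.restrict).card ≤ {p : V × V | D p.1 p.2}.ncard * κ ^ n := by
  have extend (S : Finset W) (hS : root ∈ S) (hclosed : ∀ a b, b ∈ S → T a b → a ∈ S)
      (hcard : S.card < Fintype.card W) :
      ∃ u ∈ S, ∃ w ∉ S, T u w ∧ ∀ a b, b ∈ insert w S → T a b → a ∈ insert w S := by
    obtain ⟨u, hu, w, hw, hT, huniq⟩ := exists_unique_parent_of_ne_univ hconn hindeg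
      (S := (S : Set W)) hS hclosed fun h ↦ by
        rw [Finset.coe_eq_univ] at h
        simp [h] at hcard
    refine ⟨u, hu, w, hw, hT, fun a b hb hab ↦ Finset.mem_insert_of_mem ?_⟩
    rcases Finset.mem_insert.1 hb with rfl | hb
    · exact huniq a hab ▸ hu
    · exact hclosed a b hb hab
  induction n with
  | zero =>
    obtain ⟨u, hu, w, hw, hT, hclosed⟩ := extend {root} (Finset.mem_singleton_self root)
      (fun a b hb hab ↦ absurd (Finset.mem_singleton.1 hb ▸ hab) (hroot a))
      (by rw [Finset.card_singleton]; omega)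
    obtain rfl := Finset.mem_singleton.1 hu
    refine ⟨_, by simp, hclosed, by simp [Finset.card_insert_of_notMem hw], ?_⟩
    rw [pow_zero, mul_one]
    exact card_image_restrict_pair_le F hF hT
  | succ n ih =>
    obtain ⟨S, hS, hclosed, hcard, hle⟩ := ih (by omega)
    obtain ⟨u, hu, w, hw, hT, hclosed'⟩ := extend S hS hclosed (by omega)
    refine ⟨_, Finset.mem_insert_of_mem hS, hclosed', ?_, ?_⟩
    · rw [Finset.card_insert_of_notMem hw, hcard]
    · calc (F.image (insert w S).restrict).card
          ≤ κ * (F.image S.restrict).card := card_image_restrict_insert_le hκ F hF hu hT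
        _ ≤ κ * ({p : V × V | D p.1 p.2}.ncard * κ ^ n) := Nat.mul_le_mul_left κ hle
        _ = {p : V × V | D p.1 p.2}.ncard * κ ^ (n + 1) := by ring

/-- Counting injective digraph homomorphisms of a directed rooted tree `T` (edges
oriented away from the root) into a digraph `D` with `m` edges and maximum
out-degree `κ`: there are at most `m * κ ^ (k - 2)` of them, where `k ≥ 2` is the
number of vertices of `T`. -/
theorem card_tree_embeddings_le {V W : Type*} [Fintype V] [Fintype W]
    (D : V → V → Prop) (m κ : ℕ)
    (hm : {p : V × V | D p.1 p.2}.ncard = m)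
    (hκ : ∀ v : V, {w | D v w}.ncard ≤ κ)
    (T : W → W → Prop) (root : W) (k : ℕ)
    (hk : Fintype.card W = k) (hk2 : 2 ≤ k)
    -- the underlying undirected graph of `T` is a tree
    (htree : (SimpleGraph.fromRel T).IsTree)
    -- the root has in-degree 0 in `T`
    (hroot : ∀ w : W, ¬ T w root)
    -- every non-root vertex has in-degree exactly 1 in `T`
    (hindeg : ∀ w : W, w ≠ root → {u | T u w}.ncard = 1) :
    {f : W → V | Function.Injective f ∧ ∀ a b : W, T a b → D (f a) (f b)}.ncard
      ≤ m * κ ^ (k - 2) := by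
  classical
  subst hm hk
  set F : Finset (W → V) :=
    {f | Function.Injective f ∧ ∀ a b : W, T a b → D (f a) (f b)} with hFdef
  have hF : ∀ f ∈ F, ∀ a b, T a b → D (f a) (f b) := fun f hf ↦ (Finset.mem_filter.1 hf).2.2
  obtain ⟨S, -, -, hcard, hle⟩ := exists_card_image_restrict_le hκ htree.connected hroot hindeg
    F hF (Fintype.card W - 2) (by omega)
  obtain rfl : S = Finset.univ := (Finset.card_eq_iff_eq_univ S).1 (by omega)
  rw [Finset.card_image_of_injective F fun f g hfg ↦
    funext fun x ↦ congrFun hfg ⟨x, Finset.mem_univ x⟩] at hle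
  rw [← Set.ncard_coe_finset] at hle
  simpa [hFdef] using hle
end

section
/- Let D be a finite directed acyclic graph with at least one vertex, and let T be a DRTS of D with the maximum number of vertices among all DRTSs of D. Then the root of T is a source vertex of D, i.e., the root has in-degree 0 in D. -/
/-- A directed rooted tree subgraph (DRTS) of a digraph `D`: a subgraph `T` of `D`
(given by a vertex set `verts` and an edge relation `edge`) whose underlying
undirected graph is a tree, in which the root has in-degree 0 within `T` and every
other vertex of `T` has in-degree exactly 1 within `T`. -/
structure DRTS {V : Type*} (D : V → V → Prop) where
  verts : Set V
  edge : V → V → Prop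
  root : V
  root_mem : root ∈ verts
  edge_sub : ∀ a b, edge a b → D a b
  edge_mem : ∀ a b, edge a b → a ∈ verts ∧ b ∈ verts
  /-- the underlying undirected graph of `T` is a tree -/
  tree : (SimpleGraph.fromRel fun a b : verts => edge a.1 b.1).IsTree
  /-- the root has in-degree 0 within `T` -/
  root_indeg : ∀ a, ¬ edge a root
  /-- every non-root vertex of `T` has in-degree exactly 1 within `T` -/
  indeg_one : ∀ b ∈ verts, b ≠ root → {a | edge a b}.ncard = 1

/-- A well-founded relation in which all vertices except the root have exactly one predecessor,
and the root has none, has a tree as its underlying undirected graph. -/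
theorem isTree_fromRel_of_existsUnique_pred {W : Type*} [Finite W] {r : W → W → Prop}
    (hwf : WellFounded r) {root : W} (hroot : ∀ a, ¬ r a root)
    (hpred : ∀ b, b ≠ root → ∃! a, r a b) : (SimpleGraph.fromRel r).IsTree := by
  have hirr : ∀ a, ¬ r a a := fun a h => hwf.irrefl.irrefl a h
  have hreach : ∀ b, (SimpleGraph.fromRel r).Reachable root b := by
    intro b
    induction b using hwf.induction with
    | _ b ih =>
      by_cases hb : b = root
      · rw [hb]
      · obtain ⟨a, hab, -⟩ := hpred b hb
        refine (ih a hab).trans (SimpleGraph.Adj.reachable ?_)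
        rw [SimpleGraph.fromRel_adj]
        exact ⟨fun h => hirr b (h ▸ hab), Or.inl hab⟩
  have hconn : (SimpleGraph.fromRel r).Connected :=
    SimpleGraph.connected_iff_exists_forall_reachable _ |>.mpr ⟨root, hreach⟩
  refine SimpleGraph.isTree_iff_connected_and_card.mpr
    ⟨hconn, le_antisymm ?_ hconn.card_vert_le_card_edgeSet_add_one⟩
  choose p hp hp_unique using hpred
  let e : {b // b ≠ root} → (SimpleGraph.fromRel r).edgeSet := fun b =>
    ⟨s(p b.1 b.2, b.1), by
      rw [SimpleGraph.mem_edgeSet, SimpleGraph.fromRel_adj]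
      exact ⟨fun h => hirr b.1 (by simpa only [h] using hp b.1 b.2), Or.inl (hp b.1 b.2)⟩⟩
  have hne : ∀ {x y}, r x y → y ≠ root := fun h h' => hroot _ (h' ▸ h)
  have he : Function.Surjective e := by
    rintro ⟨d, hd⟩
    induction d with
    | _ x y =>
      rw [SimpleGraph.mem_edgeSet, SimpleGraph.fromRel_adj] at hd
      rcases hd.2 with h | h
      · exact ⟨⟨y, hne h⟩, Subtype.ext (by simp only [e, ← hp_unique y (hne h) x h])⟩
      · refine ⟨⟨x, hne h⟩, Subtype.ext ?_⟩
        simp only [e, ← hp_unique x (hne h) y h]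
        exact Sym2.eq_swap
  have hcard := Nat.card_le_card_of_surjective e he
  have hlt : Nat.card {b // b ≠ root} < Nat.card W :=
    Finite.card_subtype_lt (x := root) (by simp)
  omega

namespace DRTS

variable {V : Type*} {D : V → V → Prop}

/-- Every vertex of a DRTS of a well-founded digraph is reachable from the root. -/
theorem reflTransGen_root (hwf : WellFounded D) (T : DRTS D) {b : V} (hb : b ∈ T.verts) :
    Relation.ReflTransGen D T.root b := by
  induction b using hwf.induction with
  | _ b ih =>
    by_cases h : b = T.root
    · rw [h]
    · obtain ⟨a, ha⟩ := Set.ncard_eq_one.mp (T.indeg_one b hb h)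
      have hab : T.edge a b := by
        have : a ∈ {a | T.edge a b} := ha ▸ rfl
        exact this
      exact (ih a (T.edge_sub a b hab) (T.edge_mem a b hab).1).tail (T.edge_sub a b hab)

/-- Build a DRTS of a finite well-founded digraph from the in-degree conditions alone. -/
def ofInDegree [Finite V] (hwf : WellFounded D) (verts : Set V) (edge : V → V → Prop) (root : V)
    (root_mem : root ∈ verts) (edge_sub : ∀ a b, edge a b → D a b)
    (edge_mem : ∀ a b, edge a b → a ∈ verts ∧ b ∈ verts) (root_indeg : ∀ a, ¬ edge a root)
    (indeg_one : ∀ b ∈ verts, b ≠ root → {a | edge a b}.ncard = 1) : DRTS D where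
  verts := verts
  edge := edge
  root := root
  root_mem := root_mem
  edge_sub := edge_sub
  edge_mem := edge_mem
  root_indeg := root_indeg
  indeg_one := indeg_one
  tree := by
    refine isTree_fromRel_of_existsUnique_pred (root := ⟨root, root_mem⟩)
      (Subrelation.wf (fun h => edge_sub _ _ h) (InvImage.wf Subtype.val hwf))
      (fun a => root_indeg a.1) ?_
    rintro ⟨b, hb⟩ hbr
    obtain ⟨a, ha⟩ := Set.ncard_eq_one.mp (indeg_one b hb fun h => hbr (Subtype.ext h))
    have hiff : ∀ x, edge x b ↔ x = a := fun x => Set.ext_iff.mp ha x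
    exact ⟨⟨a, (edge_mem a b ((hiff a).mpr rfl)).1⟩, (hiff a).mpr rfl,
      fun y hy => Subtype.ext ((hiff y.1).mp hy)⟩

/-- Extend a DRTS by a new root with an edge to the old one. -/
def addRoot [Finite V] (hwf : WellFounded D) (T : DRTS D) (a : V) (ha : a ∉ T.verts)
    (haD : D a T.root) : DRTS D :=
  ofInDegree hwf (insert a T.verts) (fun x y => T.edge x y ∨ (x = a ∧ y = T.root)) a
    (Set.mem_insert a _)
    (by
      rintro x y (h | ⟨rfl, rfl⟩)
      exacts [T.edge_sub x y h, haD])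
    (by
      rintro x y (h | ⟨rfl, rfl⟩)
      · exact ⟨Or.inr (T.edge_mem x y h).1, Or.inr (T.edge_mem x y h).2⟩
      · exact ⟨Or.inl rfl, Or.inr T.root_mem⟩)
    (by
      rintro x (h | ⟨-, h⟩)
      exacts [ha (T.edge_mem x a h).2, ha (h ▸ T.root_mem)])
    (by
      rintro b hb hba
      by_cases hbr : b = T.root
      · subst hbr
        simp [T.root_indeg]
      · simpa [hbr] using T.indeg_one b (hb.resolve_left hba) hbr)

end DRTS

/-- In a finite DAG with at least one vertex, the root of a DRTS with the maximum
number of vertices among all DRTSs is a source vertex of `D` (in-degree 0 in `D`). -/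
theorem root_of_max_DRTS_is_source {V : Type*} [Fintype V] [Nonempty V]
    (D : V → V → Prop)
    (hdag : ∀ v : V, ¬ Relation.TransGen D v v)
    (T : DRTS D) (hmax : ∀ T' : DRTS D, T'.verts.ncard ≤ T.verts.ncard) :
    ∀ a : V, ¬ D a T.root := by
  have : IsTrans V (Relation.TransGen D) := ⟨fun _ _ _ => Relation.TransGen.trans⟩
  have : Std.Irrefl (Relation.TransGen D) := ⟨hdag⟩
  have hwf : WellFounded D :=
    Subrelation.wf Relation.TransGen.single
      (Finite.wellFounded_of_trans_of_irrefl (Relation.TransGen D))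
  intro a haD
  have ha : a ∉ T.verts := fun h =>
    hdag a (Relation.TransGen.head' haD (T.reflTransGen_root hwf h))
  have hle : (insert a T.verts).ncard ≤ T.verts.ncard := hmax (T.addRoot hwf a ha haD)
  rw [Set.ncard_insert_of_notMem ha] at hle
  omega
end

section
/- Let H be a connected simple graph on 5 vertices that is not isomorphic to the star K_{1,4}, and let H→ be any acyclic orientation of H. Then every DRTS of H→ with the maximum number of vertices has at least three vertices; equivalently, H→ contains a DRTS on at least three vertices. -/
/-- Three distinct vertices `a`, `b`, `c` with arcs `a → b` and `p → c`, where `p` is `a` or `b`,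
span a DRTS rooted at `a`. -/
theorem exists_DRTS_three_of_arcs {V : Type*} {D : V → V → Prop} {a b c p : V}
    (hab : a ≠ b) (hac : a ≠ c) (hbc : b ≠ c) (hp : p = a ∨ p = b)
    (h₁ : D a b) (h₂ : D p c) : ∃ T : DRTS D, 3 ≤ T.verts.ncard := by
  have hp_mem : p ∈ ({a, b, c} : Set V) := by rcases hp with rfl | rfl <;> simp
  refine ⟨{ verts := {a, b, c}
            edge := fun x y => (x = a ∧ y = b) ∨ (x = p ∧ y = c)
            root := a
            root_mem := by simp
            edge_sub := ?_
            edge_mem := ?_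
            tree := ?_
            root_indeg := ?_
            indeg_one := ?_ }, ?_⟩
  · rintro x y (⟨rfl, rfl⟩ | ⟨rfl, rfl⟩) <;> assumption
  · rintro x y (⟨rfl, rfl⟩ | ⟨rfl, rfl⟩)
    · simp
    · exact ⟨hp_mem, by simp⟩
  · convert SimpleGraph.isTree_starGraph (⟨p, hp_mem⟩ : ({a, b, c} : Set V)) using 1
    ext ⟨x, hx⟩ ⟨y, hy⟩
    simp only [Set.mem_insert_iff, Set.mem_singleton_iff] at hx hy
    simp only [SimpleGraph.fromRel_adj, SimpleGraph.starGraph_adj, ne_eq, Subtype.mk.injEq]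
    grind
  · rintro x (⟨-, h⟩ | ⟨-, h⟩)
    · exact hab h
    · exact hac h
  · rintro y hy hya
    rw [Set.ncard_eq_one]
    simp only [Set.mem_insert_iff, Set.mem_singleton_iff] at hy
    rcases hy with rfl | rfl | rfl
    · exact absurd rfl hya
    · exact ⟨a, by ext x; simp [hbc]⟩
    · exact ⟨p, by ext x; simp [hbc.symm]⟩
  · exact (Set.ncard_eq_three.mpr ⟨a, b, c, hab, hac, hbc, rfl⟩).ge

/-- A star graph on `n + 1` vertices is the complete bipartite graph `K_{1,n}`. -/
theorem nonempty_starGraph_iso_completeBipartiteGraph {V : Type*} [Fintype V] {n : ℕ}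
    (hcard : Fintype.card V = n + 1) (s : V) :
    Nonempty (SimpleGraph.starGraph s ≃g completeBipartiteGraph (Fin 1) (Fin n)) := by
  classical
  have hleaves : Fintype.card {x : V // ¬ x = s} = Fintype.card (Fin n) := by
    rw [Fintype.card_subtype_compl]
    simp [hcard]
  have hcenter : Fintype.card {x : V // x = s} = Fintype.card (Fin 1) := by simp
  let e := ((Fintype.equivOfCardEq hcenter).sumCongr (Fintype.equivOfCardEq hleaves)).symm.trans
    (Equiv.sumCompl fun x : V => x = s)
  refine ⟨(RelIso.symm ⟨e, ?_⟩)⟩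
  have hl : ∀ i, e (Sum.inl i) = s := fun i =>
    ((Fintype.equivOfCardEq hcenter).symm i).2
  have hr : ∀ i, e (Sum.inr i) ≠ s := fun i =>
    ((Fintype.equivOfCardEq hleaves).symm i).2
  rintro (i | i) (j | j)
  · simp [hl]
  · simp [hl, (hr j).symm]
  · simp [hl, hr i]
  · simp [hr]

/-- A connected graph with at least two vertices, oriented so that there are no directed paths of
length two and all out-degrees are at most one, is a star. -/
theorem exists_eq_starGraph_of_orientation {V : Type*} [Nontrivial V] {H : SimpleGraph V}
    (hconn : H.Connected) {D : V → V → Prop} (hsub : ∀ a b : V, D a b → H.Adj a b)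
    (hcover : ∀ a b : V, H.Adj a b → D a b ∨ D b a)
    (hpath : ∀ a b c : V, D a b → ¬ D b c) (hout : ∀ a b c : V, D a b → D a c → b = c) :
    ∃ s, H = SimpleGraph.starGraph s := by
  obtain ⟨r, s, hrs⟩ : ∃ r s, D r s := by
    obtain ⟨u⟩ := hconn.nonempty
    obtain ⟨v, huv⟩ := hconn.preconnected.exists_adj_of_nontrivial u
    rcases hcover u v huv with h | h
    exacts [⟨_, _, h⟩, ⟨_, _, h⟩]
  have hsink : ∀ x, x = s ∨ D x s := by
    intro x
    induction (SimpleGraph.reachable_iff_reflTransGen s x).mp (hconn.preconnected s x) with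
    | refl => exact .inl rfl
    | @tail y z _ hyz ih =>
      rcases ih with rfl | hys
      · exact .inr ((hcover _ _ hyz).resolve_left (hpath _ _ _ hrs))
      · rcases hcover _ _ hyz with h | h
        · exact .inl (hout _ _ _ h hys)
        · exact absurd hys (hpath _ _ _ h)
  refine ⟨s, ?_⟩
  ext x y
  rw [SimpleGraph.starGraph_adj]
  constructor
  · refine fun hxy => ⟨hxy.ne, ?_⟩
    rcases hcover x y hxy with h | h
    · exact (hsink y).imp_right (fun hy => absurd hy (hpath _ _ _ h)) |>.symm
    · exact (hsink x).imp_right (fun hx => absurd hx (hpath _ _ _ h))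
  · rintro ⟨hxy, rfl | rfl⟩
    · exact (hsub _ _ ((hsink y).resolve_left hxy.symm)).symm
    · exact hsub _ _ ((hsink x).resolve_left hxy)

/-- Let `H` be a connected simple graph on 5 vertices that is not isomorphic to the
star `K_{1,4}`, and let `D` be any acyclic orientation of `H`. Then `D` contains a
DRTS on at least three vertices (equivalently, every maximum DRTS of `D` has at
least three vertices). -/
theorem exists_DRTS_three_of_five_vertex {V : Type*} [Fintype V]
    (hcard : Fintype.card V = 5) (H : SimpleGraph V)
    (hconn : H.Connected)
    (hstar : IsEmpty (H ≃g completeBipartiteGraph (Fin 1) (Fin 4)))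
    (D : V → V → Prop)
    -- `D` is an orientation of `H`:
    (hsub : ∀ a b : V, D a b → H.Adj a b)
    (hcover : ∀ a b : V, H.Adj a b → D a b ∨ D b a)
    -- the orientation is acyclic:
    (hdag : ∀ v : V, ¬ Relation.TransGen D v v) :
    ∃ T : DRTS D, 3 ≤ T.verts.ncard := by
  by_contra hnone
  have hne : ∀ a b : V, D a b → a ≠ b := fun a b h => (hsub a b h).ne
  have hpath : ∀ a b c : V, D a b → ¬ D b c := by
    intro a b c hab hbc
    refine hnone (exists_DRTS_three_of_arcs (hne _ _ hab) ?_ (hne _ _ hbc) (.inr rfl) hab hbc)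
    rintro rfl
    exact hdag a (.tail (.single hab) hbc)
  have hout : ∀ a b c : V, D a b → D a c → b = c := by
    intro a b c hab hac
    by_contra hbc
    exact hnone (exists_DRTS_three_of_arcs (hne _ _ hab) (hne _ _ hac) hbc (.inl rfl) hab hac)
  have : Nontrivial V := Fintype.one_lt_card_iff_nontrivial.mp (by omega)
  obtain ⟨s, rfl⟩ := exists_eq_starGraph_of_orientation hconn hsub hcover hpath hout
  obtain ⟨e⟩ := nonempty_starGraph_iso_completeBipartiteGraph hcard s
  exact hstar.false e
end

section
/- Let G be a finite simple graph, let ℓ ≥ 2 be an integer, and let G' be the graph obtained from G by replacing every edge of G by a path of length ℓ through ℓ−1 new internal vertices (distinct internal vertices for distinct edges). Then the number of subgraphs of G' isomorphic to the cycle C_{3ℓ} equals the number of triangles (subgraphs isomorphic to C₃) of G. -/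
/-- `G` is `k`-degenerate: every nonempty subgraph of `G` contains a vertex of
degree at most `k` (within that subgraph). -/
def SimpleGraph.IsKDegenerate {V : Type*} (G : SimpleGraph V) (k : ℕ) : Prop :=
  ∀ H : G.Subgraph, H.verts.Nonempty → ∃ v ∈ H.verts, {u | H.Adj v u}.ncard ≤ k

/-- The degeneracy `κ(G)` of `G`: the least `k` such that `G` is `k`-degenerate. -/
noncomputable def SimpleGraph.degeneracy {V : Type*} (G : SimpleGraph V) : ℕ :=
  sInf {k | G.IsKDegenerate k}


/-- An (arbitrarily chosen) ordered pair of the two endpoints of an edge. -/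
noncomputable def Sym2.ends {V : Type*} (e : Sym2 V) : V × V := Quot.out e

/-- The graph obtained from `G` by replacing every edge `{u,v}` of `G` by a path of
length `ℓ` from `u` to `v` through `ℓ - 1` new internal vertices (with distinct
internal vertices for distinct edges): the new internal vertices of the edge `e`
are the pairs `(e, i)` for `i : Fin (ℓ - 1)`. -/
noncomputable def SimpleGraph.pathSubdivision {V : Type*} (G : SimpleGraph V) (ℓ : ℕ) :
    SimpleGraph (V ⊕ (G.edgeSet × Fin (ℓ - 1))) :=
  SimpleGraph.fromRel fun x y =>
    match x, y with
    | Sum.inl u, Sum.inr (e, i) =>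
        (u = (Sym2.ends e.1).1 ∧ (i : ℕ) = 0) ∨ (u = (Sym2.ends e.1).2 ∧ (i : ℕ) = ℓ - 2)
    | Sum.inr (e, i), Sum.inr (e', j) => e = e' ∧ (j : ℕ) = (i : ℕ) + 1
    | _, _ => False


namespace SimpleGraph

variable {V : Type*} {G : SimpleGraph V} {ℓ : ℕ}

/-- The `j`-th vertex of the path of length `ℓ` replacing the edge of the dart `d`, the path being
traversed from `d.fst` to `d.snd`. -/
noncomputable def subdivPoint (ℓ : ℕ) (d : G.Dart) (j : ℕ) : V ⊕ (G.edgeSet × Fin (ℓ - 1)) :=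
  open Classical in
  if h0 : j = 0 then Sum.inl d.fst
  else if h : j < ℓ then
    Sum.inr (⟨d.edge, d.edge_mem⟩,
      if d.toProd = Sym2.ends d.edge then ⟨j - 1, by omega⟩ else ⟨ℓ - 1 - j, by omega⟩)
  else Sum.inl d.snd

lemma subdivPoint_zero (d : G.Dart) : subdivPoint ℓ d 0 = Sum.inl d.fst := by
  simp [subdivPoint]

lemma subdivPoint_self (hℓ : 2 ≤ ℓ) (d : G.Dart) : subdivPoint ℓ d ℓ = Sum.inl d.snd := by
  simp [subdivPoint, show ℓ ≠ 0 by omega]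

lemma subdivPoint_internal (d : G.Dart) {j : ℕ} (h0 : 0 < j) (h : j < ℓ) :
    ∃ i, subdivPoint ℓ d j = Sum.inr (⟨d.edge, d.edge_mem⟩, i) := by
  simp [subdivPoint, h0.ne', h]

lemma subdivPoint_of_eq_ends {d : G.Dart} (hd : d.toProd = Sym2.ends d.edge) {j : ℕ} (h0 : 0 < j)
    (h : j < ℓ) :
    subdivPoint ℓ d j = Sum.inr (⟨d.edge, d.edge_mem⟩, ⟨j - 1, by omega⟩) := by
  unfold subdivPoint
  rw [dif_neg h0.ne', dif_pos h, if_pos hd]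

lemma mk_ends (e : Sym2 V) : s((Sym2.ends e).1, (Sym2.ends e).2) = e := Quot.out_eq e

lemma Dart.eq_ends_or_symm (d : G.Dart) :
    d.toProd = Sym2.ends d.edge ∨ d.symm.toProd = Sym2.ends d.symm.edge := by
  have h := mk_ends d.edge
  rw [Dart.edge_symm]
  obtain ⟨⟨a, b⟩, hab⟩ := d
  simp only [Dart.edge_mk, Dart.symm_mk, Prod.swap_prod_mk] at h ⊢
  rcases Sym2.eq_iff.1 h with h | h
  · left; ext <;> simp [h]
  · right; ext <;> simp [h]

lemma Dart.not_symm_eq_ends {d : G.Dart} (h : d.toProd = Sym2.ends d.edge) :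
    d.symm.toProd ≠ Sym2.ends d.symm.edge := by
  rw [Dart.edge_symm, ← h]
  intro h'
  exact d.snd_ne_fst (congrArg Prod.fst h')

lemma subdivPoint_symm (hℓ : 2 ≤ ℓ) (d : G.Dart) {j : ℕ} (hj : j ≤ ℓ) :
    subdivPoint ℓ d.symm j = subdivPoint ℓ d (ℓ - j) := by
  rcases Nat.eq_zero_or_pos j with rfl | h0
  · simp [subdivPoint_zero, subdivPoint_self hℓ]
  rcases hj.eq_or_lt with rfl | hj
  · simp [subdivPoint_zero, subdivPoint_self hℓ]
  have h1 : ℓ - j ≠ 0 := by omega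
  have h2 : ℓ - j < ℓ := by omega
  unfold subdivPoint
  rw [dif_neg h0.ne', dif_pos hj, dif_neg h1, dif_pos h2]
  rcases d.eq_ends_or_symm with h | h
  · rw [if_neg (Dart.not_symm_eq_ends h), if_pos h]
    simp only [Dart.edge_symm]
    congr 3; omega
  · have h' : ¬ d.toProd = Sym2.ends d.edge := by
      simpa using Dart.not_symm_eq_ends h
    rw [if_pos h, if_neg h']
    simp only [Dart.edge_symm]
    congr 3; omega

/-- The dart running along an edge from the first to the second of its chosen ends. -/
noncomputable def endsDart (e : G.edgeSet) : G.Dart :=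
  ⟨Sym2.ends e.1, by
    have := e.2
    rwa [← mk_ends e.1, mem_edgeSet] at this⟩

lemma endsDart_edge (e : G.edgeSet) : (endsDart e).edge = e := mk_ends e.1

lemma endsDart_eq_ends (e : G.edgeSet) : (endsDart e).toProd = Sym2.ends (endsDart e).edge := by
  rw [endsDart_edge]; rfl

lemma subdivPoint_endsDart (e : G.edgeSet) (i : Fin (ℓ - 1)) :
    subdivPoint ℓ (endsDart e) (i + 1) = Sum.inr (e, i) := by
  rw [subdivPoint_of_eq_ends (endsDart_eq_ends e) (by omega) (by omega)]
  simp [endsDart_edge]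

lemma exists_subdivPoint_eq_inr (d : G.Dart) (i : Fin (ℓ - 1)) :
    ∃ j, 0 < j ∧ j < ℓ ∧ subdivPoint ℓ d j = Sum.inr (⟨d.edge, d.edge_mem⟩, i) := by
  by_cases h : d.toProd = Sym2.ends d.edge
  · refine ⟨i + 1, by omega, by omega, ?_⟩
    rw [subdivPoint_of_eq_ends h (by omega) (by omega)]
    simp
  · refine ⟨ℓ - 1 - i, by omega, by omega, ?_⟩
    unfold subdivPoint
    rw [dif_neg (by omega), dif_pos (by omega), if_neg h]
    congr 3; omega

/-- Before its endpoint `d.snd`, a path visits no point twice. -/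
lemma subdivPoint_inj_right (d : G.Dart) {j j' : ℕ} (hj : j < ℓ) (hj' : j' < ℓ)
    (h : subdivPoint ℓ d j = subdivPoint ℓ d j') : j = j' := by
  unfold subdivPoint at h
  split_ifs at h <;> simp at h <;> omega

lemma pathSubdivision_adj_subdivPoint (hℓ : 2 ≤ ℓ) (d : G.Dart) {j : ℕ} (hj : j < ℓ) :
    (G.pathSubdivision ℓ).Adj (subdivPoint ℓ d j) (subdivPoint ℓ d (j + 1)) := by
  have key : ∀ d : G.Dart, d.toProd = Sym2.ends d.edge → ∀ j < ℓ,
      (G.pathSubdivision ℓ).Adj (subdivPoint ℓ d j) (subdivPoint ℓ d (j + 1)) := by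
    intro d hd j hj
    unfold pathSubdivision
    rw [fromRel_adj]
    rcases Nat.eq_zero_or_pos j with rfl | h0
    · rw [subdivPoint_zero, subdivPoint_of_eq_ends hd (by omega) (by omega)]
      refine ⟨by simp, Or.inl (Or.inl ⟨?_, by simp⟩)⟩
      rw [← hd]
    rcases (show j + 1 ≤ ℓ from hj).eq_or_lt with h | h
    · rw [h, subdivPoint_self hℓ, subdivPoint_of_eq_ends hd h0 (by omega)]
      refine ⟨by simp, Or.inr (Or.inr ⟨?_, ?_⟩)⟩
      · rw [← hd]
      · simp only; omega
    · rw [subdivPoint_of_eq_ends hd h0 (by omega), subdivPoint_of_eq_ends hd (by omega) h]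
      refine ⟨?_, Or.inl ⟨rfl, ?_⟩⟩
      · simp; omega
      · simp only; omega
  rcases d.eq_ends_or_symm with h | h
  · exact key d h j hj
  · have := key _ h (ℓ - (j + 1)) (by omega)
    rw [subdivPoint_symm hℓ _ (by omega), subdivPoint_symm hℓ _ (by omega)] at this
    convert this.symm using 2 <;> omega

lemma exists_subdivPoint_of_adj (hℓ : 2 ≤ ℓ) {x y : V ⊕ (G.edgeSet × Fin (ℓ - 1))}
    (h : (G.pathSubdivision ℓ).Adj x y) :
    ∃ (d : G.Dart) (j : ℕ), j < ℓ ∧ x = subdivPoint ℓ d j ∧ y = subdivPoint ℓ d (j + 1) := by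
  have swap : ∀ {x y : V ⊕ (G.edgeSet × Fin (ℓ - 1))}, (∃ (d : G.Dart) (j : ℕ), j < ℓ ∧
      x = subdivPoint ℓ d j ∧ y = subdivPoint ℓ d (j + 1)) →
      ∃ (d : G.Dart) (j : ℕ), j < ℓ ∧ y = subdivPoint ℓ d j ∧ x = subdivPoint ℓ d (j + 1) := by
    rintro x y ⟨d, j, hj, rfl, rfl⟩
    refine ⟨d.symm, ℓ - (j + 1), by omega, ?_, ?_⟩ <;> rw [subdivPoint_symm hℓ _ (by omega)] <;>
      congr 1 <;> omega
  unfold pathSubdivision at h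
  rw [fromRel_adj] at h
  have key : ∀ {x y : V ⊕ (G.edgeSet × Fin (ℓ - 1))}, (match x, y with
      | Sum.inl u, Sum.inr (e, i) =>
        (u = (Sym2.ends e.1).1 ∧ (i : ℕ) = 0) ∨ (u = (Sym2.ends e.1).2 ∧ (i : ℕ) = ℓ - 2)
      | Sum.inr (e, i), Sum.inr (e', j) => e = e' ∧ (j : ℕ) = (i : ℕ) + 1
      | _, _ => False) → ∃ (d : G.Dart) (j : ℕ), j < ℓ ∧
        x = subdivPoint ℓ d j ∧ y = subdivPoint ℓ d (j + 1) := by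
    rintro (u | ⟨e, i⟩) (v | ⟨e', i'⟩) h
    · exact h.elim
    · rcases h with ⟨rfl, h⟩ | ⟨rfl, h⟩
      · refine ⟨endsDart e', 0, by omega, by rw [subdivPoint_zero]; rfl, ?_⟩
        rw [← subdivPoint_endsDart, h]
      · apply swap
        refine ⟨endsDart e', ℓ - 1, by omega, ?_, ?_⟩
        · rw [← subdivPoint_endsDart, h]; congr 1; omega
        · rw [Nat.sub_add_cancel (by omega), subdivPoint_self hℓ]; rfl
    · exact h.elim
    · obtain ⟨rfl, h⟩ := h
      refine ⟨endsDart e, i + 1, by omega, ?_, ?_⟩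
      · rw [subdivPoint_endsDart]
      · rw [← subdivPoint_endsDart, h]
  rcases h.2 with h | h
  · exact key h
  · exact swap (key h)

lemma subdivPoint_eq_inl_iff {d : G.Dart} {j : ℕ} (hj : j < ℓ) {u : V} :
    subdivPoint ℓ d j = Sum.inl u ↔ j = 0 ∧ d.fst = u := by
  unfold subdivPoint
  split_ifs <;> simp_all

/-- A point strictly inside a path determines the path up to its direction of traversal. -/
lemma dart_eq_or_symm_of_subdivPoint_eq {d d' : G.Dart} {j j' : ℕ} (h0 : 0 < j) (hj : j < ℓ)
    (hj' : j' < ℓ) (h : subdivPoint ℓ d j = subdivPoint ℓ d' j') : d = d' ∨ d = d'.symm := by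
  rw [← dart_edge_eq_iff]
  obtain ⟨i, hi⟩ := subdivPoint_internal d h0 hj
  rw [hi] at h
  unfold subdivPoint at h
  split_ifs at h <;> simp at h
  all_goals exact h.1

/-- The neighbours of an internal point are its predecessor and its successor. -/
lemma eq_of_adj_subdivPoint (hℓ : 2 ≤ ℓ) {d : G.Dart} {j : ℕ} (h0 : 0 < j) (hj : j < ℓ)
    {y : V ⊕ (G.edgeSet × Fin (ℓ - 1))} (h : (G.pathSubdivision ℓ).Adj (subdivPoint ℓ d j) y) :
    y = subdivPoint ℓ d (j - 1) ∨ y = subdivPoint ℓ d (j + 1) := by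
  obtain ⟨d', j', hj', hx, rfl⟩ := exists_subdivPoint_of_adj hℓ h
  rcases dart_eq_or_symm_of_subdivPoint_eq h0 hj hj' hx with rfl | rfl
  · rw [subdivPoint_inj_right _ hj hj' hx]; exact Or.inr rfl
  · rcases Nat.eq_zero_or_pos j' with rfl | h0'
    · rw [subdivPoint_zero, subdivPoint_eq_inl_iff hj] at hx
      omega
    rw [subdivPoint_symm hℓ _ hj.le] at hx
    have := subdivPoint_inj_right _ (by omega) hj' hx
    left
    rw [subdivPoint_symm hℓ _ (by omega)]
    congr 1; omega

lemma exists_dart_reverse (hℓ : 2 ≤ ℓ) {P : G.Dart → Prop} (hP : ∀ d, P d → P d.symm)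
    {x y : V ⊕ (G.edgeSet × Fin (ℓ - 1))}
    (h : ∃ d, P d ∧ ∃ j < ℓ, x = subdivPoint ℓ d j ∧ y = subdivPoint ℓ d (j + 1)) :
    ∃ d, P d ∧ ∃ j < ℓ, y = subdivPoint ℓ d j ∧ x = subdivPoint ℓ d (j + 1) := by
  obtain ⟨d, hd, j, hj, rfl, rfl⟩ := h
  refine ⟨d.symm, hP d hd, ℓ - (j + 1), by omega, ?_, ?_⟩ <;>
    rw [subdivPoint_symm hℓ _ (by omega)] <;> congr 1 <;> omega

namespace Subgraph

/-- The vertices of the subdivision of a subgraph. -/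
def subdivVerts (ℓ : ℕ) (H : G.Subgraph) : Set (V ⊕ (G.edgeSet × Fin (ℓ - 1))) :=
  Sum.elim (· ∈ H.verts) (fun z => z.1.1 ∈ H.edgeSet)

@[simp] lemma inl_mem_subdivVerts {H : G.Subgraph} {u : V} :
    Sum.inl u ∈ H.subdivVerts ℓ ↔ u ∈ H.verts := Iff.rfl

@[simp] lemma inr_mem_subdivVerts {H : G.Subgraph} {z : G.edgeSet × Fin (ℓ - 1)} :
    Sum.inr z ∈ H.subdivVerts ℓ ↔ z.1.1 ∈ H.edgeSet := Iff.rfl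

lemma subdivPoint_mem_subdivVerts {H : G.Subgraph} {d : G.Dart} (hd : H.Adj d.fst d.snd) (j : ℕ) :
    subdivPoint ℓ d j ∈ H.subdivVerts ℓ := by
  unfold subdivPoint
  split_ifs
  · exact H.edge_vert hd
  · exact hd
  · exact hd
  · exact H.edge_vert hd.symm

/-- The subgraph of the subdivision of `G` obtained by subdividing a subgraph of `G`. -/
def subdivide (hℓ : 2 ≤ ℓ) (H : G.Subgraph) : (G.pathSubdivision ℓ).Subgraph where
  verts := H.subdivVerts ℓ
  Adj x y := ∃ d : G.Dart, H.Adj d.fst d.snd ∧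
    ∃ j < ℓ, x = subdivPoint ℓ d j ∧ y = subdivPoint ℓ d (j + 1)
  adj_sub := by
    rintro _ _ ⟨d, -, j, hj, rfl, rfl⟩
    exact pathSubdivision_adj_subdivPoint hℓ d hj
  edge_vert := by
    rintro _ _ ⟨d, hd, j, -, rfl, -⟩
    exact subdivPoint_mem_subdivVerts hd j
  symm := ⟨fun _ _ => exists_dart_reverse hℓ fun _ h => h.symm⟩

lemma subdivide_injective (hℓ : 2 ≤ ℓ) :
    Function.Injective (subdivide hℓ : G.Subgraph → (G.pathSubdivision ℓ).Subgraph) := by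
  intro H H' h
  have hv : H.subdivVerts ℓ = H'.subdivVerts ℓ := congrArg Subgraph.verts h
  have he : ∀ e : G.edgeSet, e.1 ∈ H.edgeSet ↔ e.1 ∈ H'.edgeSet := fun e => by
    have := Set.ext_iff.1 hv (Sum.inr (e, ⟨0, by omega⟩))
    simpa using this
  refine Subgraph.ext ?_ ?_
  · ext u
    have := Set.ext_iff.1 hv (Sum.inl u)
    simpa using this
  · ext u v
    constructor <;> intro h
    · exact (he ⟨s(u, v), h.adj_sub⟩).1 h
    · exact (he ⟨s(u, v), h.adj_sub⟩).2 h

lemma nonempty_iso_cycleGraph {S : G.Subgraph} {n : ℕ} (hn : 2 ≤ n) {f : ℕ → V}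
    (hf : ∀ i j, f i = f j ↔ i ≡ j [MOD n]) (hv : ∀ x, x ∈ S.verts ↔ ∃ k, f k = x)
    (hadj : ∀ x y, S.Adj x y ↔ ∃ k, (x = f k ∧ y = f (k + 1)) ∨ (y = f k ∧ x = f (k + 1))) :
    Nonempty (S.coe ≃g cycleGraph n) := by
  let g : Fin n → S.verts := fun i => ⟨f i, (hv _).2 ⟨i, rfl⟩⟩
  have hg : Function.Bijective g := by
    constructor
    · intro i j h
      have := (hf i j).1 (congrArg Subtype.val h)
      exact Fin.ext (Nat.ModEq.eq_of_lt_of_lt this i.2 j.2)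
    · rintro ⟨x, hx⟩
      obtain ⟨k, rfl⟩ := (hv x).1 hx
      exact ⟨⟨k % n, Nat.mod_lt _ (by omega)⟩, Subtype.ext ((hf _ _).2 (Nat.mod_modEq k n))⟩
  have hsub : ∀ i j : Fin n, (i - j).val = 1 ↔ (i : ℕ) ≡ j + 1 [MOD n] := by
    intro i j
    rw [Fin.val_sub, Nat.ModEq]
    have := i.2
    have := j.2
    rw [Nat.mod_eq_of_lt i.2]
    rcases (show j.1 + 1 ≤ n from j.2).eq_or_lt with h | h
    · rw [h, Nat.mod_self, show n - j.1 + i = i + 1 by omega]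
      rcases (show i.1 + 1 ≤ n from i.2).eq_or_lt with h' | h'
      · rw [h', Nat.mod_self]; omega
      · rw [Nat.mod_eq_of_lt h']; omega
    · rw [Nat.mod_eq_of_lt h]
      rcases le_or_gt j.1 i.1 with h' | h'
      · rw [show n - j.1 + i = (i - j) + n by omega, Nat.add_mod_right, Nat.mod_eq_of_lt (by omega)]
        omega
      · rw [Nat.mod_eq_of_lt (by omega)]; omega
  refine ⟨RelIso.symm ⟨Equiv.ofBijective g hg, ?_⟩⟩
  intro i j
  rw [cycleGraph_adj', hsub, hsub]
  change S.Adj (f i) (f j) ↔ _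
  rw [hadj]
  constructor
  · rintro ⟨k, ⟨h1, h2⟩ | ⟨h1, h2⟩⟩
    · rw [hf] at h1 h2
      exact Or.inr (h2.trans (h1.symm.add_right 1))
    · rw [hf] at h1 h2
      exact Or.inl (h2.trans (h1.symm.add_right 1))
  · rintro (h | h)
    · exact ⟨j, Or.inr ⟨rfl, (hf _ _).2 h⟩⟩
    · exact ⟨i, Or.inl ⟨rfl, (hf _ _).2 h⟩⟩

lemma nonempty_subdivide_iso_cycleGraph (hℓ : 2 ≤ ℓ) {H : G.Subgraph}
    (h : Nonempty (H.coe ≃g cycleGraph 3)) :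
    Nonempty ((H.subdivide hℓ).coe ≃g cycleGraph (3 * ℓ)) := by
  obtain ⟨φ⟩ := h
  rw [cycleGraph_three_eq_top] at φ
  let w : ZMod 3 → V := fun i => (φ.symm i : V)
  have hw : Function.Injective w := Subtype.val_injective.comp φ.symm.injective
  have hwadj : ∀ i j, i ≠ j → H.Adj (w i) (w j) := by
    intro i j hij
    exact (φ.symm.map_rel_iff (a := i) (b := j)).2 hij
  have hwv : ∀ u, u ∈ H.verts ↔ ∃ i, w i = u := by
    intro u
    constructor
    · intro hu
      exact ⟨φ ⟨u, hu⟩, by simp [w]⟩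
    · rintro ⟨i, rfl⟩
      exact (φ.symm i).2
  have hsucc : ∀ i : ZMod 3, i ≠ i + 1 := by decide
  have hcases : ∀ i j : ZMod 3, i ≠ j → j = i + 1 ∨ i = j + 1 := by decide
  have htwo : ∀ i j : ZMod 3, i = j + 1 → i + 1 = j → False := by decide
  let D : ZMod 3 → G.Dart := fun i => ⟨(w i, w (i + 1)), (hwadj _ _ (hsucc i)).adj_sub⟩
  have hD : ∀ i, H.Adj (D i).fst (D i).snd := fun i => hwadj _ _ (hsucc i)
  have hdart : ∀ d : G.Dart, H.Adj d.fst d.snd → ∃ i, d = D i ∨ d = (D i).symm := by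
    rintro ⟨⟨a, b⟩, hab⟩ hd
    obtain ⟨i, rfl⟩ := (hwv a).1 (H.edge_vert hd)
    obtain ⟨j, rfl⟩ := (hwv b).1 (H.edge_vert hd.symm)
    rcases hcases i j (fun h => hd.ne (congrArg w h)) with rfl | rfl
    · exact ⟨i, Or.inl rfl⟩
    · exact ⟨j, Or.inr rfl⟩
  have hDinj : ∀ i i' r r', r < ℓ → r' < ℓ →
      subdivPoint ℓ (D i) r = subdivPoint ℓ (D i') r' → i = i' ∧ r = r' := by
    intro i i' r r' hr hr' h
    have hi : i = i' := by
      rcases Nat.eq_zero_or_pos r with rfl | h0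
      · rw [subdivPoint_zero, eq_comm, subdivPoint_eq_inl_iff hr'] at h
        exact (hw h.2).symm
      · rcases dart_eq_or_symm_of_subdivPoint_eq h0 hr hr' h with h | h
        · exact hw (congrArg (fun d : G.Dart => d.fst) h)
        · exact (htwo i i' (hw (congrArg (fun d : G.Dart => d.fst) h))
            (hw (congrArg (fun d : G.Dart => d.snd) h))).elim
    subst hi
    exact ⟨rfl, subdivPoint_inj_right _ hr hr' h⟩
  let f : ℕ → V ⊕ (G.edgeSet × Fin (ℓ - 1)) := fun k => subdivPoint ℓ (D (k / ℓ : ℕ)) (k % ℓ)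
  have hf_eq : ∀ (i : ZMod 3) (r : ℕ), r < ℓ → f (i.val * ℓ + r) = subdivPoint ℓ (D i) r := by
    intro i r hr
    simp only [f]
    rw [Nat.mul_add_mod_of_lt hr, mul_comm, Nat.mul_add_div (by omega), Nat.div_eq_of_lt hr]
    simp
  have hf_succ : ∀ k, f (k + 1) = subdivPoint ℓ (D (k / ℓ : ℕ)) (k % ℓ + 1) := by
    intro k
    have hk := Nat.div_add_mod k ℓ
    have hlt := Nat.mod_lt k (show 0 < ℓ by omega)
    generalize k / ℓ = a at *
    generalize k % ℓ = r at *
    subst hk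
    simp only [f]
    rcases (show r + 1 ≤ ℓ from hlt).eq_or_lt with h | h
    · rw [add_assoc, h, Nat.add_mod_right, Nat.mul_mod_right, Nat.add_div_right _ (by omega),
        Nat.mul_div_cancel_left _ (by omega), subdivPoint_zero, subdivPoint_self hℓ]
      simp [D]
    · rw [add_assoc, Nat.mul_add_mod, Nat.mul_add_div (by omega), Nat.mod_eq_of_lt h,
        Nat.div_eq_of_lt h, add_zero]
  have hpos : 0 < ℓ := by omega
  refine nonempty_iso_cycleGraph (f := f) (by omega) ?_ ?_ ?_
  · intro i j
    rw [mul_comm, Nat.ModEq, Nat.mod_mul, Nat.mod_mul]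
    constructor
    · intro h
      obtain ⟨h1, h2⟩ := hDinj _ _ _ _ (Nat.mod_lt _ hpos) (Nat.mod_lt _ hpos) h
      rw [ZMod.natCast_eq_natCast_iff, Nat.ModEq] at h1
      rw [h1, h2]
    · intro h
      have h2 : i % ℓ = j % ℓ := by
        have := congrArg (· % ℓ) h
        simpa using this
      rw [h2] at h
      have h1 : i / ℓ ≡ j / ℓ [MOD 3] :=
        Nat.eq_of_mul_eq_mul_left hpos (Nat.add_left_cancel h)
      rw [← ZMod.natCast_eq_natCast_iff] at h1
      simp only [f, h1, h2]
  · intro x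
    constructor
    · intro hx
      rcases x with u | ⟨e, i⟩
      · obtain ⟨i, rfl⟩ := (hwv u).1 hx
        exact ⟨i.val * ℓ + 0, by rw [hf_eq _ _ hpos, subdivPoint_zero]⟩
      · have hx' : H.Adj (endsDart e).fst (endsDart e).snd := by
          have : e.1 ∈ H.edgeSet := hx
          rw [← endsDart_edge e] at this
          exact this
        obtain ⟨a, ha⟩ := hdart _ hx'
        have hedge : e = ⟨(D a).edge, (D a).edge_mem⟩ :=
          Subtype.ext (by rw [← endsDart_edge e]; exact dart_edge_eq_iff _ _ |>.2 ha)
        obtain ⟨j, -, hj, h⟩ := exists_subdivPoint_eq_inr (D a) i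
        exact ⟨a.val * ℓ + j, by rw [hf_eq _ _ hj, h, ← hedge]⟩
    · rintro ⟨k, rfl⟩
      exact subdivPoint_mem_subdivVerts (hD _) _
  · intro x y
    constructor
    · rintro ⟨d, hd, j, hj, rfl, rfl⟩
      obtain ⟨a, rfl | rfl⟩ := hdart d hd
      · refine ⟨a.val * ℓ + j, Or.inl ⟨(hf_eq _ _ hj).symm, ?_⟩⟩
        rw [hf_succ, Nat.mul_add_mod_of_lt hj, mul_comm, Nat.mul_add_div hpos, Nat.div_eq_of_lt hj]
        simp
      · have hj' : ℓ - (j + 1) < ℓ := by omega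
        refine ⟨a.val * ℓ + (ℓ - (j + 1)), Or.inr ⟨?_, ?_⟩⟩
        · rw [hf_eq _ _ hj', subdivPoint_symm hℓ _ (by omega)]
        · rw [hf_succ, Nat.mul_add_mod_of_lt hj', mul_comm, Nat.mul_add_div hpos,
            Nat.div_eq_of_lt hj', subdivPoint_symm hℓ _ hj.le, show ℓ - (j + 1) + 1 = ℓ - j by omega]
          simp
    · rintro ⟨k, ⟨rfl, rfl⟩ | ⟨rfl, rfl⟩⟩
      · exact ⟨_, hD _, _, Nat.mod_lt _ hpos, rfl, hf_succ k⟩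
      · exact Adj.symm ⟨_, hD _, _, Nat.mod_lt _ hpos, rfl, hf_succ k⟩

lemma neighborSet_ncard_of_iso {S : G.Subgraph} {n : ℕ} (φ : S.coe ≃g cycleGraph (n + 3)) {x : V}
    (hx : x ∈ S.verts) : (S.neighborSet x).ncard = 2 := by
  rw [← cycleGraph_degree_three_le (v := φ ⟨x, hx⟩), ← card_neighborSet_eq_degree,
    ← Nat.card_eq_fintype_card, ← Nat.card_coe_set_eq]
  exact Nat.card_congr ((coeNeighborSetEquiv ⟨x, hx⟩).symm.trans (φ.mapNeighborSet ⟨x, hx⟩))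

section Contract

variable {S : (G.pathSubdivision ℓ).Subgraph}

lemma adj_subdivPoint_of_mem (hℓ : 2 ≤ ℓ) (hS : ∀ x ∈ S.verts, (S.neighborSet x).ncard = 2)
    {d : G.Dart} {j : ℕ} (h0 : 0 < j) (hj : j < ℓ) (h : subdivPoint ℓ d j ∈ S.verts) :
    S.Adj (subdivPoint ℓ d j) (subdivPoint ℓ d (j - 1)) ∧
      S.Adj (subdivPoint ℓ d j) (subdivPoint ℓ d (j + 1)) := by
  have hsub : S.neighborSet (subdivPoint ℓ d j) ⊆
      {subdivPoint ℓ d (j - 1), subdivPoint ℓ d (j + 1)} :=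
    fun y hy => eq_of_adj_subdivPoint hℓ h0 hj hy.adj_sub
  have heq := Set.eq_of_subset_of_ncard_le hsub
    (by rw [hS _ h]; exact (Set.ncard_insert_le _ _).trans (by simp)) (Set.toFinite _)
  constructor
  · change _ ∈ S.neighborSet _
    rw [heq]; simp
  · change _ ∈ S.neighborSet _
    rw [heq]; simp

lemma subdivPoint_mem_of_mem (hℓ : 2 ≤ ℓ) (hS : ∀ x ∈ S.verts, (S.neighborSet x).ncard = 2)
    {d : G.Dart} {j k : ℕ} (h0 : 0 < j) (hj : j < ℓ) (h : subdivPoint ℓ d j ∈ S.verts)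
    (hk : k ≤ ℓ) : subdivPoint ℓ d k ∈ S.verts := by
  have up : ∀ d : G.Dart, ∀ j, 0 < j → subdivPoint ℓ d j ∈ S.verts → ∀ k, j ≤ k → k ≤ ℓ →
      subdivPoint ℓ d k ∈ S.verts := by
    intro d j h0 h k hjk
    induction k, hjk using Nat.le_induction with
    | base => exact fun _ => h
    | succ k hjk ih =>
      intro hk
      exact S.edge_vert (adj_subdivPoint_of_mem hℓ hS (by omega) hk (ih (by omega))).2.symm
  rcases le_total j k with hjk | hjk
  · exact up d j h0 h k hjk hk
  · have := up d.symm (ℓ - j) (by omega)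
      (by rwa [subdivPoint_symm hℓ _ (by omega), Nat.sub_sub_self hj.le]) (ℓ - k) (by omega)
      (by omega)
    rwa [subdivPoint_symm hℓ _ (by omega), Nat.sub_sub_self hk] at this

lemma adj_subdivPoint_succ_of_mem (hℓ : 2 ≤ ℓ)
    (hS : ∀ x ∈ S.verts, (S.neighborSet x).ncard = 2) {d : G.Dart}
    (h : subdivPoint ℓ d 1 ∈ S.verts) {j : ℕ} (hj : j < ℓ) :
    S.Adj (subdivPoint ℓ d j) (subdivPoint ℓ d (j + 1)) := by
  rcases Nat.eq_zero_or_pos j with rfl | h0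
  · exact (adj_subdivPoint_of_mem hℓ hS one_pos hℓ h).1.symm
  · exact (adj_subdivPoint_of_mem hℓ hS h0 hj
      (subdivPoint_mem_of_mem hℓ hS one_pos hℓ h hj.le)).2

/-- Every 2-regular subgraph of the subdivision is the subdivision of a subgraph. -/
lemma exists_subdivide_eq (hℓ : 2 ≤ ℓ) (hS : ∀ x ∈ S.verts, (S.neighborSet x).ncard = 2) :
    ∃ H : G.Subgraph, H.subdivide hℓ = S := by
  let H : G.Subgraph :=
    { verts := {u | Sum.inl u ∈ S.verts}
      Adj := fun u v => ∃ h : G.Adj u v, subdivPoint ℓ ⟨(u, v), h⟩ 1 ∈ S.verts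
      adj_sub := fun h => h.1
      edge_vert := by
        rintro u v ⟨h, h'⟩
        have := subdivPoint_mem_of_mem hℓ hS one_pos hℓ h' (Nat.zero_le _)
        rwa [subdivPoint_zero] at this
      symm := ⟨by
        rintro u v ⟨h, h'⟩
        refine ⟨h.symm, ?_⟩
        have := subdivPoint_mem_of_mem hℓ hS one_pos hℓ h' (show ℓ - 1 ≤ ℓ by omega)
        rwa [← subdivPoint_symm hℓ _ (by omega)] at this⟩ }
  have hadj : ∀ d : G.Dart, H.Adj d.fst d.snd ↔ subdivPoint ℓ d 1 ∈ S.verts :=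
    fun d => ⟨fun h => h.2, fun h => ⟨d.adj, h⟩⟩
  refine ⟨H, Subgraph.ext ?_ ?_⟩
  · ext x
    rcases x with u | ⟨e, i⟩
    · rfl
    · have h1 : Sum.inr (e, i) ∈ (H.subdivide hℓ).verts ↔
          H.Adj (endsDart e).fst (endsDart e).snd := by
        change e.1 ∈ H.edgeSet ↔ (endsDart e).edge ∈ H.edgeSet
        rw [endsDart_edge]
      rw [h1, hadj, ← subdivPoint_endsDart]
      constructor <;> intro h
      · exact subdivPoint_mem_of_mem hℓ hS one_pos hℓ h (by omega)
      · exact subdivPoint_mem_of_mem hℓ hS (by omega) (by omega) h (by omega)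
  · ext x y
    constructor
    · rintro ⟨d, hd, j, hj, rfl, rfl⟩
      exact adj_subdivPoint_succ_of_mem hℓ hS ((hadj d).1 hd) hj
    · intro h
      obtain ⟨d, j, hj, rfl, rfl⟩ := exists_subdivPoint_of_adj hℓ h.adj_sub
      refine ⟨d, (hadj d).2 ?_, j, hj, rfl, rfl⟩
      rcases Nat.eq_zero_or_pos j with rfl | h0
      · exact S.edge_vert h.symm
      · exact subdivPoint_mem_of_mem hℓ hS h0 hj (S.edge_vert h) (by omega)

end Contract

lemma ncard_neighborSet_subdivide (hℓ : 2 ≤ ℓ) (H : G.Subgraph) (u : V) :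
    ((H.subdivide hℓ).neighborSet (Sum.inl u)).ncard = (H.neighborSet u).ncard := by
  symm
  refine Set.ncard_congr (fun v hv => subdivPoint ℓ ⟨(u, v), H.adj_sub hv⟩ 1) ?_ ?_ ?_
  · intro v hv
    exact ⟨⟨(u, v), H.adj_sub hv⟩, hv, 0, by omega, (subdivPoint_zero (G := G) ⟨(u, v), H.adj_sub hv⟩).symm, rfl⟩
  · intro v v' hv hv' h
    rcases dart_eq_or_symm_of_subdivPoint_eq one_pos hℓ hℓ h with h | h
    · exact congrArg (fun d : G.Dart => d.snd) h
    · exact (H.adj_sub hv').ne (congrArg (fun d : G.Dart => d.fst) h) |>.elim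
  · rintro y ⟨d, hd, j, hj, hx, rfl⟩
    obtain ⟨rfl, rfl⟩ := (subdivPoint_eq_inl_iff hj).1 hx.symm
    exact ⟨d.snd, hd, rfl⟩

lemma ncard_verts_subdivide [Finite V] (hℓ : 2 ≤ ℓ) (H : G.Subgraph) :
    (H.subdivide hℓ).verts.ncard = H.verts.ncard + H.edgeSet.ncard * (ℓ - 1) := by
  have hverts : (H.subdivide hℓ).verts = Sum.inl '' H.verts ∪
      Sum.inr '' ((Subtype.val ⁻¹' H.edgeSet : Set G.edgeSet) ×ˢ
        (Set.univ : Set (Fin (ℓ - 1)))) := by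
    ext (u | ⟨e, i⟩)
    · change u ∈ H.verts ↔ _
      simp
    · change e.1 ∈ H.edgeSet ↔ _
      simp
  rw [hverts, Set.ncard_union_eq (by simp [Set.disjoint_left]) (Set.toFinite _) (Set.toFinite _),
    Set.ncard_image_of_injective _ Sum.inl_injective,
    Set.ncard_image_of_injective _ Sum.inr_injective, Set.ncard_prod, Set.ncard_univ,
    Nat.card_fin, Set.ncard_preimage_of_injective_subset_range Subtype.val_injective]
  rw [Subtype.range_coe]
  exact H.edgeSet_subset

lemma ncard_edgeSet_of_two_regular [Fintype V] {H : G.Subgraph}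
    (hH : ∀ u ∈ H.verts, (H.neighborSet u).ncard = 2) : H.edgeSet.ncard = H.verts.ncard := by
  classical
  have hsum := H.spanningCoe.sum_degrees_eq_twice_card_edges
  have hdeg : ∀ u, H.spanningCoe.degree u = if u ∈ H.verts then 2 else 0 := by
    intro u
    rw [← card_neighborSet_eq_degree, ← Nat.card_eq_fintype_card, Nat.card_coe_set_eq]
    change (H.neighborSet u).ncard = _
    split_ifs with hu
    · exact hH u hu
    · rw [Set.ncard_eq_zero, Set.eq_empty_iff_forall_notMem]
      exact fun v hv => hu (H.edge_vert hv)
  simp_rw [hdeg] at hsum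
  rw [← Finset.sum_filter, Finset.sum_const, smul_eq_mul, ← Set.ncard_coe_finset,
    ← Set.ncard_coe_finset, coe_edgeFinset, edgeSet_spanningCoe] at hsum
  have hset : ((Finset.univ.filter (· ∈ H.verts) : Finset V) : Set V) = H.verts := by
    ext; simp
  rw [hset] at hsum
  omega

lemma nonempty_iso_cycleGraph_three [Finite V] {H : G.Subgraph} (hcard : H.verts.ncard = 3)
    (hH : ∀ u ∈ H.verts, (H.neighborSet u).ncard = 2) : Nonempty (H.coe ≃g cycleGraph 3) := by
  have hadj : ∀ u ∈ H.verts, ∀ v ∈ H.verts, u ≠ v → H.Adj u v := by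
    intro u hu v hv huv
    have heq : H.neighborSet u = H.verts \ {u} := by
      refine Set.eq_of_subset_of_ncard_le ?_ ?_ (Set.toFinite _)
      · exact fun w hw => ⟨H.edge_vert hw.symm, hw.ne.symm⟩
      · rw [hH u hu, Set.ncard_sdiff_singleton_of_mem hu, hcard]
    change v ∈ H.neighborSet u
    rw [heq]
    exact ⟨hv, huv.symm⟩
  have htop : H.coe = ⊤ := by
    ext u v
    rw [SimpleGraph.top_adj]
    exact ⟨fun h => h.ne, fun h => hadj _ u.2 _ v.2 (Subtype.coe_ne_coe.2 h)⟩
  rw [htop, cycleGraph_three_eq_top]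
  exact ⟨Iso.completeGraph (Finite.equivFinOfCardEq hcard)⟩

end Subgraph

end SimpleGraph


/-- For `ℓ ≥ 2`, the number of subgraphs isomorphic to the cycle `C_{3ℓ}` in the
graph obtained from a finite simple graph `G` by replacing every edge by a path of
length `ℓ` (through `ℓ - 1` new internal vertices, distinct for distinct edges)
equals the number of triangles (subgraphs isomorphic to `C₃`) of `G`. -/
theorem count_cycles_pathSubdivision {V : Type*} [Fintype V]
    (G : SimpleGraph V) (ℓ : ℕ) (hℓ : 2 ≤ ℓ) :
    {S : (G.pathSubdivision ℓ).Subgraph |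
        Nonempty (S.coe ≃g SimpleGraph.cycleGraph (3 * ℓ))}.ncard
      = {S : G.Subgraph | Nonempty (S.coe ≃g SimpleGraph.cycleGraph 3)}.ncard := by
  rw [← Set.ncard_image_of_injective _ (SimpleGraph.Subgraph.subdivide_injective (G := G) hℓ)]
  refine congrArg Set.ncard ?_
  ext S
  constructor
  · rintro ⟨φ⟩
    have hcard : S.verts.ncard = 3 * ℓ := by
      rw [← Nat.card_coe_set_eq, Nat.card_congr φ.toEquiv, Nat.card_fin]
    have hdeg : ∀ x ∈ S.verts, (S.neighborSet x).ncard = 2 := by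
      obtain ⟨n, hn⟩ : ∃ n, 3 * ℓ = n + 3 := ⟨3 * ℓ - 3, by omega⟩
      rw [hn] at φ
      exact fun x hx => SimpleGraph.Subgraph.neighborSet_ncard_of_iso φ hx
    obtain ⟨H, rfl⟩ := SimpleGraph.Subgraph.exists_subdivide_eq hℓ hdeg
    have hH : ∀ u ∈ H.verts, (H.neighborSet u).ncard = 2 := fun u hu => by
      rw [← SimpleGraph.Subgraph.ncard_neighborSet_subdivide hℓ]
      exact hdeg _ hu
    refine ⟨H, SimpleGraph.Subgraph.nonempty_iso_cycleGraph_three ?_ hH, rfl⟩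
    rw [SimpleGraph.Subgraph.ncard_verts_subdivide,
      SimpleGraph.Subgraph.ncard_edgeSet_of_two_regular hH] at hcard
    obtain ⟨m, rfl⟩ : ∃ m, ℓ = m + 1 := ⟨ℓ - 1, by omega⟩
    refine Nat.eq_of_mul_eq_mul_right (show 0 < m + 1 by omega) ?_
    rw [← hcard, Nat.add_sub_cancel]
    ring
  · rintro ⟨H, hH, rfl⟩
    exact SimpleGraph.Subgraph.nonempty_subdivide_iso_cycleGraph hℓ hH
end
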